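/- arXiv:2002.10128 — 2 statements merged into one kernel-verified Lean document; each statement's English description precedes it below -/
import Mathlib

section
/- Let G_s(w₀) := ∫_{(-1/2,1/2]^d} ∫₁^∞ (1 − exp(−η w₀ w r_s^α / ‖x‖^α)) β w^{−β−1} dw dx for w₀ ≥ 1 and s > e. Then lim_{s→∞} (s/k!) ∫₁^∞ (s·G_s(w₀))^k · exp(−s·G_s(w₀)) · β w₀^{−β−1} dw₀ = e^{−ξ}. (This is the analytic form, obtained from the Campbell–Mecke formula, of the statement that the expected number E[D_k] of degree-k vertices in the scale-free random connection model G(P_s, r_s) on the unit torus converges to e^{−ξ}.) -/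
open MeasureTheory Filter Set

lemma aux_pow_exp (k : ℕ) (x : ℝ) (hx : 0 ≤ x) :
    x ^ k * Real.exp (-x) ≤ (2 ^ k * (k.factorial : ℝ)) * Real.exp (-(x / 2)) := by
  have h := Real.pow_div_factorial_le_exp (x / 2) (by positivity) k
  have hk : (0 : ℝ) < k.factorial := by positivity
  rw [div_le_iff₀ hk, div_pow, div_le_iff₀ (by positivity)] at h
  have h2 : Real.exp (-x) = Real.exp (-(x / 2)) * Real.exp (-(x / 2)) := by
    rw [← Real.exp_add]; ring_nf
  have h3 : Real.exp (x / 2) * Real.exp (-(x / 2)) = 1 := by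
    rw [← Real.exp_add]; simp
  calc x ^ k * Real.exp (-x) ≤ (Real.exp (x / 2) * k.factorial * 2 ^ k) * Real.exp (-x) := by
        gcongr
    _ = (2 ^ k * (k.factorial : ℝ)) * (Real.exp (x / 2) * Real.exp (-(x / 2))) * Real.exp (-(x / 2)) := by
        rw [h2]; ring
    _ = _ := by rw [h3]; ring

lemma aux_cov (k : ℕ) (δ β L : ℝ) (hδ : 0 < δ) (hL : 0 < L) :
    ∫ w in Ioi (1 : ℝ), (L * w ^ δ) ^ k * Real.exp (-(L * w ^ δ)) * (β * w ^ (-β - 1)) =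
    (β / δ * (L ^ k / (L * Real.exp L))) *
      ∫ u in Ioi (0 : ℝ), (1 + u / L) ^ ((k : ℝ) - β / δ - 1) * Real.exp (-u) := by
  have himg : (fun u : ℝ => (1 + u / L) ^ (1 / δ)) '' Ioi 0 = Ioi 1 := by
    ext w
    constructor
    · rintro ⟨u, hu, rfl⟩
      have hu' : 0 < u := hu
      have : 0 < u / L := by positivity
      exact Real.one_lt_rpow (by linarith) (by positivity)
    · intro hw
      have hw' : 1 < w := hw
      refine ⟨L * (w ^ δ - 1), ?_, ?_⟩
      · have := Real.one_lt_rpow hw' hδ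
        exact mul_pos hL (by linarith)
      · have : 1 + L * (w ^ δ - 1) / L = w ^ δ := by field_simp; ring
        simp only [this]
        rw [← Real.rpow_mul (by linarith)]
        simp [hδ.ne']
  have hinj : InjOn (fun u : ℝ => (1 + u / L) ^ (1 / δ)) (Ioi 0) := by
    apply StrictMonoOn.injOn
    intro a ha b hb hab
    have ha' : 0 < a := ha
    have : 0 < a / L := by positivity
    have : a / L < b / L := by gcongr
    exact Real.rpow_lt_rpow (by linarith) (by linarith) (by positivity)
  have hder : ∀ u ∈ Ioi (0 : ℝ), HasDerivWithinAt (fun u : ℝ => (1 + u / L) ^ (1 / δ))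
      ((1 / L) * (1 / δ) * (1 + u / L) ^ (1 / δ - 1)) (Ioi 0) u := by
    intro u hu
    have hu' : 0 < u := hu
    have : 0 < u / L := by positivity
    have h1 : HasDerivAt (fun u : ℝ => 1 + u / L) (1 / L) u := by
      simpa using ((hasDerivAt_id u).div_const L).const_add 1
    exact (h1.rpow_const (Or.inl (by linarith))).hasDerivWithinAt
  rw [← himg, integral_image_eq_integral_abs_deriv_smul measurableSet_Ioi hder hinj,
    ← integral_const_mul]
  apply setIntegral_congr_fun measurableSet_Ioi
  intro u hu
  have hu' : 0 < u := hu
  have h0 : 0 < u / L := by positivity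
  have hb : 0 < 1 + u / L := by linarith
  simp only [smul_eq_mul]
  rw [abs_of_nonneg (by positivity), ← Real.rpow_mul hb.le, ← Real.rpow_mul hb.le]
  have e1 : (1 / δ) * δ = 1 := by field_simp
  rw [e1, Real.rpow_one]
  have e2 : L * (1 + u / L) = L + u := by field_simp
  have e3 : (1 + u / L) ^ ((k : ℝ) - β / δ - 1) =
      (1 + u / L) ^ k * ((1 + u / L) ^ (1 / δ - 1) * (1 + u / L) ^ (1 / δ * (-β - 1))) := by
    rw [← Real.rpow_natCast, ← Real.rpow_add hb, ← Real.rpow_add hb]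
    congr 1; field_simp; ring
  rw [e3, mul_pow, e2, neg_add, Real.exp_add, Real.exp_neg L]
  field_simp

lemma aux_laplace (k : ℕ) (δ β : ℝ) (hδ : 0 < δ) (hβ : 0 < β) :
    Tendsto (fun L : ℝ => (L * Real.exp L / L ^ k) *
      ∫ w in Ioi (1 : ℝ), (L * w ^ δ) ^ k * Real.exp (-(L * w ^ δ)) * (β * w ^ (-β - 1)))
      atTop (nhds (β / δ)) := by
  have key : Tendsto (fun L : ℝ =>
      ∫ u in Ioi (0 : ℝ), (1 + u / L) ^ ((k : ℝ) - β / δ - 1) * Real.exp (-u))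
      atTop (nhds (∫ u in Ioi (0 : ℝ), Real.exp (-u))) := by
    apply tendsto_integral_filter_of_dominated_convergence
      (fun u => Real.exp 1 * ((2 ^ k * (k.factorial : ℝ)) * Real.exp (-(1 / 2) * (1 + u))))
    · filter_upwards [] with L
      apply Measurable.aestronglyMeasurable
      fun_prop
    · filter_upwards [eventually_ge_atTop 1] with L hL
      filter_upwards [ae_restrict_mem measurableSet_Ioi] with u hu
      have hu' : 0 < u := hu
      have h0 : 0 < u / L := by positivity
      have h1 : u / L ≤ u := div_le_self hu'.le hL
      rw [Real.norm_of_nonneg (by positivity)]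
      have h2 := aux_pow_exp k (1 + u) (by linarith)
      have h3 : (1 + u / L) ^ ((k : ℝ) - β / δ - 1) ≤ (1 + u) ^ k := by
        calc (1 + u / L) ^ ((k : ℝ) - β / δ - 1) ≤ (1 + u / L) ^ (k : ℝ) := by
              apply Real.rpow_le_rpow_of_exponent_le (by linarith)
              have : 0 < β / δ := by positivity
              linarith
          _ = (1 + u / L) ^ k := Real.rpow_natCast _ _
          _ ≤ _ := by gcongr
      calc _ ≤ (1 + u) ^ k * Real.exp (-u) := by gcongr
        _ = Real.exp 1 * ((1 + u) ^ k * Real.exp (-(1 + u))) := by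
            have : Real.exp (-u) = Real.exp 1 * Real.exp (-(1 + u)) := by
              rw [← Real.exp_add]; ring_nf
            rw [this]; ring
        _ ≤ _ := by
            have e : -(1 / 2) * (1 + u) = -((1 + u) / 2) := by ring
            rw [e]
            exact mul_le_mul_of_nonneg_left h2 (Real.exp_pos 1).le
    · have h := (exp_neg_integrableOn_Ioi 0 (b := 1 / 2) (by norm_num))
      have := (h.const_mul (Real.exp (-(1/2)))).const_mul (2 ^ k * (k.factorial : ℝ))
      have := this.const_mul (Real.exp 1)
      refine this.congr ?_
      filter_upwards [] with u
      rw [← Real.exp_add]; ring_nf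
    · filter_upwards [ae_restrict_mem measurableSet_Ioi] with u hu
      have h1 : Tendsto (fun L : ℝ => 1 + u / L) atTop (nhds (1 + 0)) :=
        (tendsto_const_nhds.div_atTop tendsto_id).const_add 1
      have h2 := h1.rpow_const (p := (k : ℝ) - β / δ - 1) (Or.inl (by norm_num))
      have h3 := h2.mul_const (Real.exp (-u))
      simpa using h3
  rw [integral_exp_neg_Ioi_zero] at key
  have key2 := key.const_mul (β / δ)
  rw [mul_one] at key2
  refine key2.congr' ?_
  filter_upwards [eventually_gt_atTop 0] with L hL
  rw [aux_cov k δ β L hδ hL]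
  have := Real.exp_pos L
  field_simp

lemma aux_one_sub_exp (c : ℝ) (hc : 0 ≤ c) :
    ENNReal.ofReal (1 - Real.exp (-c)) =
      ∫⁻ v in Ioi (0 : ℝ), (Iio c).indicator (fun v => ENNReal.ofReal (Real.exp (-v))) v := by
  rw [setLIntegral_indicator measurableSet_Iio]
  have h1 : Iio c ∩ Ioi (0:ℝ) = Ioo 0 c := by ext; simp [and_comm]
  rw [h1, setLIntegral_congr Ioo_ae_eq_Ioc]
  rw [← ofReal_integral_eq_lintegral_ofReal]
  · rw [← intervalIntegral.integral_of_le hc]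
    congr 1
    have : ∀ v ∈ uIcc 0 c, HasDerivAt (fun v => -Real.exp (-v)) (Real.exp (-v)) v := by
      intro v _
      have := ((hasDerivAt_neg v).exp).neg
      simp only [mul_neg, mul_one, neg_neg] at this
      exact this
    rw [intervalIntegral.integral_eq_sub_of_hasDerivAt this]
    · simp; ring
    · apply Continuous.intervalIntegrable; fun_prop
  · apply Continuous.integrableOn_Ioc; fun_prop
  · filter_upwards [] with v; positivity

lemma aux_full (d : ℕ) (hd : 1 ≤ d) (α : ℝ) (hαd : (d : ℝ) < α) (b : ℝ) (hb : 0 < b) :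
    ∫⁻ x : EuclideanSpace ℝ (Fin d), ENNReal.ofReal (1 - Real.exp (-(b / ‖x‖ ^ α))) =
      ENNReal.ofReal ((volume (Metric.closedBall (0 : EuclideanSpace ℝ (Fin d)) 1)).toReal *
        (b ^ ((d : ℝ) / α) * Real.Gamma (1 - (d : ℝ) / α))) := by
  have hd0 : (0 : ℝ) < d := by exact_mod_cast hd
  have hα : 0 < α := by linarith
  have : Nonempty (Fin d) := ⟨⟨0, hd⟩⟩
  simp_rw [fun x : EuclideanSpace ℝ (Fin d) => aux_one_sub_exp (b / ‖x‖ ^ α) (by positivity)]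
  rw [lintegral_lintegral_swap]
  · have h1 : ∀ v ∈ Ioi (0 : ℝ), (∫⁻ x : EuclideanSpace ℝ (Fin d),
        (Iio (b / ‖x‖ ^ α)).indicator (fun v => ENNReal.ofReal (Real.exp (-v))) v) =
        ENNReal.ofReal (Real.exp (-v) * v ^ (1 - (d : ℝ) / α - 1) * b ^ ((d : ℝ) / α)) *
          volume (Metric.closedBall (0 : EuclideanSpace ℝ (Fin d)) 1) := by
      intro v hv
      have hv' : 0 < v := hv
      have h2 : ∀ᵐ x : EuclideanSpace ℝ (Fin d),
          (Iio (b / ‖x‖ ^ α)).indicator (fun v => ENNReal.ofReal (Real.exp (-v))) v =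
          (Metric.ball (0 : EuclideanSpace ℝ (Fin d)) ((b / v) ^ (1 / α))).indicator
            (fun _ => ENNReal.ofReal (Real.exp (-v))) x := by
        have hne : ∀ᵐ x : EuclideanSpace ℝ (Fin d), x ≠ 0 := by
          simp [ae_iff]
        filter_upwards [hne] with x hx
        have hx0 : 0 < ‖x‖ := norm_pos_iff.mpr hx
        have hiff : v ∈ Iio (b / ‖x‖ ^ α) ↔
            x ∈ Metric.ball (0 : EuclideanSpace ℝ (Fin d)) ((b / v) ^ (1 / α)) := by
          rw [mem_Iio, mem_ball_zero_iff, one_div, Real.lt_rpow_inv_iff_of_pos hx0.le (by positivity) hα,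
            lt_div_iff₀ (by positivity), lt_div_iff₀ hv', mul_comm]
        by_cases hx1 : v ∈ Iio (b / ‖x‖ ^ α)
        · rw [indicator_of_mem hx1, indicator_of_mem (hiff.mp hx1)]
        · rw [indicator_of_notMem hx1, indicator_of_notMem (fun h => hx1 (hiff.mpr h))]
      rw [lintegral_congr_ae h2, lintegral_indicator_const measurableSet_ball,
        Measure.addHaar_ball _ _ (by positivity), ← mul_assoc, ← ENNReal.ofReal_mul (by positivity),
        Measure.addHaar_closedBall _ _ zero_le_one]
      simp only [finrank_euclideanSpace, Fintype.card_fin, one_pow, ENNReal.ofReal_one, one_mul]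
      congr 2
      rw [← Real.rpow_natCast, ← Real.rpow_mul (by positivity), Real.div_rpow hb.le hv'.le]
      have : 1 - (d : ℝ) / α - 1 = -(1 / α * d) := by ring
      rw [this, Real.rpow_neg hv'.le]
      have : (d : ℝ) / α = 1 / α * d := by ring
      rw [this]
      field_simp
    rw [setLIntegral_congr_fun measurableSet_Ioi h1, lintegral_mul_const _ (by fun_prop)]
    have hδ : (d : ℝ) / α < 1 := by rw [div_lt_one hα]; exact hαd
    have hδ' : 0 < 1 - (d : ℝ) / α := by linarith
    rw [← ofReal_integral_eq_lintegral_ofReal]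
    · rw [integral_mul_const, ← Real.Gamma_eq_integral hδ', ENNReal.ofReal_mul (p := (volume _).toReal) ENNReal.toReal_nonneg,
        ENNReal.ofReal_toReal measure_closedBall_lt_top.ne, mul_comm, mul_comm (Real.Gamma _)]
    · exact (Real.GammaIntegral_convergent hδ').mul_const _
    · filter_upwards [ae_restrict_mem measurableSet_Ioi] with v hv
      have hv' : 0 < v := hv
      simp only [Pi.zero_apply]
      positivity
  · apply Measurable.aemeasurable
    have : (Function.uncurry fun (x : EuclideanSpace ℝ (Fin d)) (v : ℝ) =>
        (Iio (b / ‖x‖ ^ α)).indicator (fun v => ENNReal.ofReal (Real.exp (-v))) v) =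
        {p : EuclideanSpace ℝ (Fin d) × ℝ | p.2 < b / ‖p.1‖ ^ α}.indicator
          (fun p => ENNReal.ofReal (Real.exp (-p.2))) := by
      ext p
      simp [Function.uncurry, indicator]
    rw [this]
    apply Measurable.indicator (by fun_prop)
    apply measurableSet_lt <;> fun_prop


lemma aux_pareto (β p : ℝ) (hp : p < β) :
    IntegrableOn (fun w : ℝ => w ^ p * (β * w ^ (-β - 1))) (Ioi 1) ∧
    ∫ w in Ioi (1 : ℝ), w ^ p * (β * w ^ (-β - 1)) = β / (β - p) := by
  have e : EqOn (fun w : ℝ => w ^ p * (β * w ^ (-β - 1))) (fun w => β * w ^ (p - β - 1)) (Ioi 1) := by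
    intro w hw
    have hw' : (0 : ℝ) < w := lt_trans one_pos hw
    have : p - β - 1 = p + (-β - 1) := by ring
    simp only
    rw [this, Real.rpow_add hw']
    ring
  constructor
  · rw [integrableOn_congr_fun e measurableSet_Ioi]
    exact (integrableOn_Ioi_rpow_of_lt (by linarith) one_pos).const_mul β
  · rw [setIntegral_congr_fun measurableSet_Ioi e, integral_const_mul,
      integral_Ioi_rpow_of_lt (by linarith) one_pos]
    have : p - β ≠ 0 := by linarith
    have : β - p ≠ 0 := by linarith
    have e2 : p - β - 1 + 1 = -(β - p) := by ring
    rw [e2, Real.one_rpow, neg_div_neg_eq]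
    ring

noncomputable def auxF (d : ℕ) (α β a : ℝ) (z : EuclideanSpace ℝ (Fin d) × ℝ) : ℝ :=
  (1 - Real.exp (-(a * z.2 / ‖z.1‖ ^ α))) * (β * z.2 ^ (-β - 1))

lemma auxF_nonneg (d : ℕ) (α β a : ℝ) (hβ : 0 < β) (ha : 0 ≤ a)
    (x : EuclideanSpace ℝ (Fin d)) (w : ℝ) (hw : w ∈ Ioi (1 : ℝ)) : 0 ≤ auxF d α β a (x, w) := by
  have hw' : (0 : ℝ) < w := lt_trans one_pos hw
  unfold auxF
  have : Real.exp (-(a * w / ‖x‖ ^ α)) ≤ 1 := by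
    rw [Real.exp_le_one_iff]
    have : 0 ≤ a * w / ‖x‖ ^ α := by positivity
    linarith
  have h1 : 0 ≤ 1 - Real.exp (-(a * w / ‖x‖ ^ α)) := by linarith
  simp only
  positivity

lemma auxF_meas (d : ℕ) (α β a : ℝ) : Measurable (auxF d α β a) := by
  unfold auxF
  fun_prop

lemma auxF_lint (d : ℕ) (hd : 1 ≤ d) (α β a : ℝ) (hαd : (d : ℝ) < α) (hβ : 1 < β) (ha : 0 < a) :
    ∫⁻ z, ENNReal.ofReal (auxF d α β a z)
      ∂((volume : Measure (EuclideanSpace ℝ (Fin d))).prod (volume.restrict (Ioi (1 : ℝ)))) =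
    ENNReal.ofReal ((volume (Metric.closedBall (0 : EuclideanSpace ℝ (Fin d)) 1)).toReal *
      (β / (β - d / α)) * Real.Gamma (1 - (d : ℝ) / α) * a ^ ((d : ℝ) / α)) := by
  have hd0 : (0 : ℝ) < d := by exact_mod_cast hd
  have hα : 0 < α := by linarith
  have hδ : (d : ℝ) / α < 1 := by rw [div_lt_one hα]; exact hαd
  have hGa : 0 < Real.Gamma (1 - (d : ℝ) / α) := Real.Gamma_pos_of_pos (by linarith)
  rw [lintegral_prod_symm _ ((auxF_meas d α β a).ennreal_ofReal.aemeasurable)]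
  have h1 : ∀ w ∈ Ioi (1 : ℝ), ∫⁻ x : EuclideanSpace ℝ (Fin d), ENNReal.ofReal (auxF d α β a (x, w)) =
      ENNReal.ofReal (((volume (Metric.closedBall (0 : EuclideanSpace ℝ (Fin d)) 1)).toReal *
        Real.Gamma (1 - (d : ℝ) / α) * a ^ ((d : ℝ) / α)) *
        (w ^ ((d : ℝ) / α) * (β * w ^ (-β - 1)))) := by
    intro w hw
    have hw' : (0 : ℝ) < w := lt_trans one_pos hw
    unfold auxF
    simp only
    have hc : 0 ≤ β * w ^ (-β - 1) := by positivity
    simp_rw [ENNReal.ofReal_mul' hc]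
    rw [lintegral_mul_const _ (by fun_prop), aux_full d hd α hαd (a * w) (by positivity),
      ← ENNReal.ofReal_mul' hc, Real.mul_rpow ha.le hw'.le]
    congr 1
    ring
  rw [setLIntegral_congr_fun measurableSet_Ioi h1, ← ofReal_integral_eq_lintegral_ofReal]
  · rw [integral_const_mul, (aux_pareto β _ (hδ.trans hβ)).2]
    congr 1
    ring
  · exact (aux_pareto β _ (hδ.trans hβ)).1.const_mul _
  · filter_upwards [ae_restrict_mem measurableSet_Ioi] with w hw
    have hw' : (0 : ℝ) < w := lt_trans one_pos hw
    simp only [Pi.zero_apply]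
    positivity

lemma auxF_ae (d : ℕ) (α β a : ℝ) (hβ : 0 < β) (ha : 0 ≤ a) :
    0 ≤ᵐ[(volume : Measure (EuclideanSpace ℝ (Fin d))).prod (volume.restrict (Ioi (1 : ℝ)))]
      auxF d α β a := by
  have h : ∀ᵐ z ∂((volume : Measure (EuclideanSpace ℝ (Fin d))).prod
      (volume.restrict (Ioi (1 : ℝ)))), z.2 ∈ Ioi (1 : ℝ) :=
    Measure.quasiMeasurePreserving_snd.ae (ae_restrict_mem measurableSet_Ioi)
  filter_upwards [h] with z hz
  exact auxF_nonneg d α β a hβ ha z.1 z.2 hz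

lemma auxF_integrable (d : ℕ) (hd : 1 ≤ d) (α β a : ℝ) (hαd : (d : ℝ) < α) (hβ : 1 < β)
    (ha : 0 < a) : Integrable (auxF d α β a)
      ((volume : Measure (EuclideanSpace ℝ (Fin d))).prod (volume.restrict (Ioi (1 : ℝ)))) := by
  refine ⟨(auxF_meas d α β a).aestronglyMeasurable, ?_⟩
  rw [hasFiniteIntegral_iff_ofReal (auxF_ae d α β a (by linarith) ha.le),
    auxF_lint d hd α β a hαd hβ ha]
  exact ENNReal.ofReal_lt_top

noncomputable def auxK (d : ℕ) (α β a : ℝ) (x : EuclideanSpace ℝ (Fin d)) : ℝ :=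
  ∫ w in Ioi (1 : ℝ), (1 - Real.exp (-(a * w / ‖x‖ ^ α))) * (β * w ^ (-β - 1))

lemma auxK_integrable (d : ℕ) (hd : 1 ≤ d) (α β a : ℝ) (hαd : (d : ℝ) < α) (hβ : 1 < β)
    (ha : 0 < a) : Integrable (auxK d α β a) :=
  (auxF_integrable d hd α β a hαd hβ ha).integral_prod_left

lemma auxK_integral (d : ℕ) (hd : 1 ≤ d) (α β a : ℝ) (hαd : (d : ℝ) < α) (hβ : 1 < β)
    (ha : 0 < a) : ∫ x, auxK d α β a x = 
    (volume (Metric.closedBall (0 : EuclideanSpace ℝ (Fin d)) 1)).toReal *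
      (β / (β - d / α)) * Real.Gamma (1 - (d : ℝ) / α) * a ^ ((d : ℝ) / α) := by
  have hd0 : (0 : ℝ) < d := by exact_mod_cast hd
  have hα : 0 < α := by linarith
  have hδ : (d : ℝ) / α < 1 := by rw [div_lt_one hα]; exact hαd
  have hGa : 0 < Real.Gamma (1 - (d : ℝ) / α) := Real.Gamma_pos_of_pos (by linarith)
  have hb : 0 < β - d / α := by linarith
  have h := integral_prod _ (auxF_integrable d hd α β a hαd hβ ha)
  rw [integral_eq_lintegral_of_nonneg_ae (auxF_ae d α β a (by linarith) ha.le)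
    (auxF_meas d α β a).aestronglyMeasurable, auxF_lint d hd α β a hαd hβ ha,
    ENNReal.toReal_ofReal (by positivity)] at h
  exact h.symm

lemma auxK_nonneg (d : ℕ) (α β a : ℝ) (hβ : 0 < β) (ha : 0 ≤ a)
    (x : EuclideanSpace ℝ (Fin d)) : 0 ≤ auxK d α β a x :=
  setIntegral_nonneg measurableSet_Ioi (fun w hw => auxF_nonneg d α β a hβ ha x w hw)

lemma auxF_integrableOn (d : ℕ) (α β a : ℝ) (hβ : 1 < β) (ha : 0 ≤ a)
    (x : EuclideanSpace ℝ (Fin d)) :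
    IntegrableOn (fun w : ℝ => (1 - Real.exp (-(a * w / ‖x‖ ^ α))) * (β * w ^ (-β - 1))) (Ioi 1) := by
  refine Integrable.mono' (aux_pareto β 0 (by linarith)).1
    (Measurable.aestronglyMeasurable (by fun_prop)) ?_
  filter_upwards [ae_restrict_mem measurableSet_Ioi] with w hw
  have hw' : (0 : ℝ) < w := lt_trans one_pos hw
  have := auxF_nonneg d α β a (by linarith) ha x w hw
  unfold auxF at this
  simp only at this
  rw [Real.norm_of_nonneg this, Real.rpow_zero]
  have := Real.exp_pos (-(a * w / ‖x‖ ^ α))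
  gcongr
  linarith

lemma auxK_mono (d : ℕ) (α β a b : ℝ) (hβ : 1 < β) (ha : 0 ≤ a) (hab : a ≤ b)
    (x : EuclideanSpace ℝ (Fin d)) : auxK d α β a x ≤ auxK d α β b x := by
  apply setIntegral_mono_on (auxF_integrableOn d α β a hβ ha x)
    (auxF_integrableOn d α β b hβ (ha.trans hab) x) measurableSet_Ioi
  intro w hw
  have hw' : (0 : ℝ) < w := lt_trans one_pos hw
  gcongr

lemma auxK_le (d : ℕ) (α β a : ℝ) (hβ : 1 < β) (ha : 0 ≤ a)
    (x : EuclideanSpace ℝ (Fin d)) : auxK d α β a x ≤ a * (β / (β - 1)) / ‖x‖ ^ α := by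
  have h1 := aux_pareto β 1 hβ
  calc auxK d α β a x ≤ ∫ w in Ioi (1 : ℝ), (a / ‖x‖ ^ α) * (w ^ (1 : ℝ) * (β * w ^ (-β - 1))) := by
        apply setIntegral_mono_on (auxF_integrableOn d α β a hβ ha x) (h1.1.const_mul _)
          measurableSet_Ioi
        intro w hw
        have hw' : (0 : ℝ) < w := lt_trans one_pos hw
        have := Real.add_one_le_exp (-(a * w / ‖x‖ ^ α))
        have hc : 0 ≤ β * w ^ (-β - 1) := by positivity
        have h5 : 1 - Real.exp (-(a * w / ‖x‖ ^ α)) ≤ a * w / ‖x‖ ^ α := by linarith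
        refine (mul_le_mul_of_nonneg_right h5 hc).trans (le_of_eq ?_)
        rw [Real.rpow_one]
        ring
    _ = _ := by rw [integral_const_mul, h1.2]; ring

lemma aux_core (d : ℕ) (hd : 1 ≤ d) (α β : ℝ) (hαd : (d : ℝ) < α) (hβ : 1 < β) :
    ∃ C : ℝ, 0 ≤ C ∧ ∀ a : ℝ, 0 < a →
      (∫ x in {x : EuclideanSpace ℝ (Fin d) | ∀ i, x i ∈ Ioc (-(1 : ℝ) / 2) (1 / 2)},
        auxK d α β a x) ≤ (volume (Metric.closedBall (0 : EuclideanSpace ℝ (Fin d)) 1)).toReal *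
      (β / (β - d / α)) * Real.Gamma (1 - (d : ℝ) / α) * a ^ ((d : ℝ) / α) ∧
      (volume (Metric.closedBall (0 : EuclideanSpace ℝ (Fin d)) 1)).toReal *
      (β / (β - d / α)) * Real.Gamma (1 - (d : ℝ) / α) * a ^ ((d : ℝ) / α) - C * a ≤
      (∫ x in {x : EuclideanSpace ℝ (Fin d) | ∀ i, x i ∈ Ioc (-(1 : ℝ) / 2) (1 / 2)},
        auxK d α β a x) := by
  have hd0 : (0 : ℝ) < d := by exact_mod_cast hd
  have hα : 0 < α := by linarith
  set B := {x : EuclideanSpace ℝ (Fin d) | ∀ i, x i ∈ Ioc (-(1 : ℝ) / 2) (1 / 2)} with hB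
  have hBm : MeasurableSet B := by
    have : B = ⋂ i, (fun x : EuclideanSpace ℝ (Fin d) => x i) ⁻¹' Ioc (-(1 : ℝ) / 2) (1 / 2) := by
      ext x; simp [hB]
    rw [this]
    refine MeasurableSet.iInter fun i => ?_
    have hm : Measurable (fun x : EuclideanSpace ℝ (Fin d) => x i) := by fun_prop
    exact hm measurableSet_Ioc
  have hI : Integrable (fun x : EuclideanSpace ℝ (Fin d) => (1 + ‖x‖) ^ (-α)) :=
    integrable_one_add_norm (by simpa using hαd)
  have hb1 : 0 < β - 1 := by linarith
  refine ⟨(β / (β - 1)) * 3 ^ α * ∫ x : EuclideanSpace ℝ (Fin d), (1 + ‖x‖) ^ (-α), ?_, ?_⟩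
  · have : 0 ≤ ∫ x : EuclideanSpace ℝ (Fin d), (1 + ‖x‖) ^ (-α) :=
      integral_nonneg fun x => by positivity
    positivity
  intro a ha
  have hK := auxK_integrable d hd α β a hαd hβ ha
  have hKn : ∀ x, 0 ≤ auxK d α β a x := auxK_nonneg d α β a (by linarith) ha.le
  rw [← auxK_integral d hd α β a hαd hβ ha]
  constructor
  · exact setIntegral_le_integral hK (Eventually.of_forall hKn)
  · have hc := setIntegral_compl hBm hK
    have h2 : ∫ x in Bᶜ, auxK d α β a x ≤
        ∫ x in Bᶜ, (a * (β / (β - 1)) * 3 ^ α) * (1 + ‖x‖) ^ (-α) := by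
      apply setIntegral_mono_on hK.integrableOn (hI.const_mul _).integrableOn hBm.compl
      intro x hx
      refine (auxK_le d α β a hβ ha.le x).trans ?_
      have hx2 : 1 / 2 ≤ ‖x‖ := by
        by_contra hlt
        push Not at hlt
        apply hx
        intro i
        have h := (PiLp.norm_apply_le x i).trans_lt hlt
        rw [Real.norm_eq_abs, abs_lt] at h
        constructor <;> linarith [h.1, h.2]
      have hx0 : 0 < ‖x‖ := by linarith
      rw [Real.rpow_neg (by positivity), mul_assoc (a * _), ← div_eq_mul_inv,
        div_eq_mul_inv (a * _)]
      gcongr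
      rw [← Real.div_rpow (by positivity) (by positivity), ← Real.inv_rpow (by positivity)]
      apply Real.rpow_le_rpow (by positivity) _ hα.le
      rw [inv_eq_one_div, div_le_div_iff₀ hx0 (by positivity)]
      linarith
    have h3 : ∫ x in Bᶜ, (a * (β / (β - 1)) * 3 ^ α) * (1 + ‖x‖) ^ (-α) ≤
        ∫ x : EuclideanSpace ℝ (Fin d), (a * (β / (β - 1)) * 3 ^ α) * (1 + ‖x‖) ^ (-α) :=
      setIntegral_le_integral (hI.const_mul _) (Eventually.of_forall fun x => by
        simp only [Pi.zero_apply]; positivity)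
    have h4 := integral_const_mul (μ := (volume : Measure (EuclideanSpace ℝ (Fin d))))
      (a * (β / (β - 1)) * 3 ^ α) (fun x : EuclideanSpace ℝ (Fin d) => (1 + ‖x‖) ^ (-α))
    have e : (β / (β - 1)) * 3 ^ α * (∫ x : EuclideanSpace ℝ (Fin d), (1 + ‖x‖) ^ (-α)) * a =
      a * (β / (β - 1)) * 3 ^ α * (∫ x : EuclideanSpace ℝ (Fin d), (1 + ‖x‖) ^ (-α)) := by ring
    rw [e]
    linarith

lemma aux_cmp (k : ℕ) (x H t : ℝ) (hx : 1 ≤ x) (ht0 : 0 ≤ t) (ht1 : t ≤ 1)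
    (h1 : x - t ≤ H) (h2 : H ≤ x) :
    |H ^ k * Real.exp (-H) - x ^ k * Real.exp (-x)| ≤
      ((Real.exp t - 1) + (1 - (1 - t) ^ k)) * (x ^ k * Real.exp (-x)) := by
  have hH : 0 ≤ H := by linarith
  have hp : 0 < x ^ k * Real.exp (-x) := by positivity
  have ha : 1 ≤ Real.exp t := Real.one_le_exp ht0
  have hb : (1 - t) ^ k ≤ 1 := pow_le_one₀ (by linarith) (by linarith)
  have hup : H ^ k * Real.exp (-H) ≤ Real.exp t * (x ^ k * Real.exp (-x)) := by
    calc H ^ k * Real.exp (-H) ≤ x ^ k * Real.exp (t + -x) := by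
          gcongr; linarith
      _ = _ := by rw [Real.exp_add]; ring
  have hlo : (1 - t) ^ k * (x ^ k * Real.exp (-x)) ≤ H ^ k * Real.exp (-H) := by
    rw [← mul_assoc, ← mul_pow]
    have h0 : 0 ≤ (1 - t) * x := mul_nonneg (by linarith) (by linarith)
    have h3 : (1 - t) * x ≤ H := by nlinarith
    gcongr
  have i1 := mul_nonneg (sub_nonneg.mpr ha) hp.le
  have i2 := mul_nonneg (sub_nonneg.mpr hb) hp.le
  rw [abs_le]
  constructor <;> nlinarith

lemma aux_L_div (k : ℕ) (A : ℝ) :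
    Tendsto (fun s : ℝ => (Real.log s + ((k : ℝ) - 1) * Real.log (Real.log s) + A) / Real.log s)
      atTop (nhds 1) := by
  have h1 : Tendsto (fun y : ℝ => Real.log y / y) atTop (nhds 0) := by
    have := (Real.isLittleO_log_id_atTop).tendsto_div_nhds_zero
    simpa using this
  have h2 : Tendsto (fun y : ℝ => A / y) atTop (nhds 0) := tendsto_const_nhds.div_atTop tendsto_id
  have h3 : Tendsto (fun y : ℝ => 1 + ((k : ℝ) - 1) * (Real.log y / y) + A / y) atTop
      (nhds (1 + ((k : ℝ) - 1) * 0 + 0)) := ((h1.const_mul _).const_add 1).add h2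
  have h4 := h3.comp Real.tendsto_log_atTop
  simp only [mul_zero, add_zero] at h4
  refine h4.congr' ?_
  filter_upwards [eventually_gt_atTop 1] with s hs
  have := Real.log_pos hs
  simp only [Function.comp]
  field_simp

lemma aux_L_norm (k : ℕ) (A : ℝ) (L : ℝ → ℝ)
    (hL : ∀ s, L s = Real.log s + ((k : ℝ) - 1) * Real.log (Real.log s) + A) :
    Tendsto (fun s : ℝ => s * (L s ^ k / (L s * Real.exp (L s)))) atTop (nhds (Real.exp (-A))) := by
  have h1 : Tendsto (fun s => L s / Real.log s) atTop (nhds 1) := by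
    simp_rw [hL]; exact aux_L_div k A
  have h2 := ((h1.pow k).div h1 one_ne_zero).mul_const (Real.exp (-A))
  simp only [one_pow, div_one, one_mul] at h2
  refine h2.congr' ?_
  filter_upwards [eventually_gt_atTop 1, h1.eventually (lt_mem_nhds one_pos)] with s hs hLs
  have hl := Real.log_pos hs
  have hs0 : 0 < s := by linarith
  have hLp : 0 < L s := by
    have := mul_pos hLs hl
    rwa [div_mul_cancel₀ _ hl.ne'] at this
  have he : Real.exp (L s) = s * (Real.log s ^ k / Real.log s) * Real.exp A := by
    rw [hL s, Real.exp_add, Real.exp_add, Real.exp_log hs0, mul_comm ((k : ℝ) - 1),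
      Real.exp_mul, Real.exp_log hl, Real.rpow_sub hl, Real.rpow_one, Real.rpow_natCast]
  rw [he, Real.exp_neg]
  have := Real.exp_pos A
  simp only [Pi.div_apply, div_pow]
  field_simp

lemma aux_asym (k : ℕ) (δ β A : ℝ) (hδ : 0 < δ) (hβ : 0 < β) (L ε : ℝ → ℝ) (H : ℝ → ℝ → ℝ)
    (hL : ∀ s, L s = Real.log s + ((k : ℝ) - 1) * Real.log (Real.log s) + A)
    (hε : Tendsto ε atTop (nhds 0))
    (hH : ∀ᶠ s in atTop, 0 ≤ ε s ∧ MonotoneOn (H s) (Ioi 1) ∧ (∀ w ∈ Ioi (1 : ℝ), 0 ≤ H s w) ∧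
      (∀ w ∈ Ioi (1 : ℝ), H s w ≤ L s * w ^ δ) ∧
      (∀ w ∈ Ioi (1 : ℝ), L s * w ^ δ - ε s * w ≤ H s w)) :
    Tendsto (fun s : ℝ => s * ∫ w in Ioi (1 : ℝ),
        H s w ^ k * Real.exp (-(H s w)) * (β * w ^ (-β - 1))) atTop
      (nhds (Real.exp (-A) * (β / δ))) := by
  set M : ℝ := 10 ^ (1 / δ) with hM
  have hM1 : 1 < M := Real.one_lt_rpow (by norm_num) (by positivity)
  have hMδ : M ^ δ = 10 := by
    rw [hM, ← Real.rpow_mul (by norm_num)]; simp [hδ.ne']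
  have hdiv : Tendsto (fun s => L s / Real.log s) atTop (nhds 1) := by
    simp_rw [hL]; exact aux_L_div k A
  have hLtop : Tendsto L atTop atTop := by
    have := hdiv.pos_mul_atTop one_pos Real.tendsto_log_atTop
    refine this.congr' ?_
    filter_upwards [eventually_gt_atTop 1] with s hs
    have := Real.log_pos hs
    field_simp
  set J : ℝ → ℝ := fun s => ∫ w in Ioi (1 : ℝ),
    (L s * w ^ δ) ^ k * Real.exp (-(L s * w ^ δ)) * (β * w ^ (-β - 1)) with hJ
  have hJlim : Tendsto (fun s => s * J s) atTop (nhds (Real.exp (-A) * (β / δ))) := by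
    have h1 := (aux_L_norm k A L hL).mul ((aux_laplace k δ β hδ hβ).comp hLtop)
    refine h1.congr' ?_
    filter_upwards [hLtop.eventually_gt_atTop 0] with s hs
    simp only [Function.comp, hJ]
    generalize (∫ w in Ioi (1 : ℝ),
      (L s * w ^ δ) ^ k * Real.exp (-(L s * w ^ δ)) * (β * w ^ (-β - 1))) = Z
    have := Real.exp_pos (L s)
    field_simp
  set D : ℝ := 2 ^ k * (k.factorial : ℝ) with hD
  have hD0 : 0 < D := by positivity
  set e : ℝ → ℝ := fun s => (Real.exp (ε s * M) - 1) + (1 - (1 - ε s * M) ^ k) with he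
  have hpar := aux_pareto β 0 hβ
  simp only [Real.rpow_zero, one_mul, sub_zero, div_self hβ.ne'] at hpar
  have hεM : Tendsto (fun s => ε s * M) atTop (nhds 0) := by simpa using hε.mul_const M
  have he0 : Tendsto e atTop (nhds 0) := by
    have h1 := (Real.continuous_exp.tendsto 0).comp hεM
    have h2 := (hεM.const_sub 1).pow k
    have := (h1.sub_const 1).add (h2.const_sub 1)
    simpa [he, Function.comp_def] using this
  have hbound : ∀ᶠ s in atTop, ‖(s * ∫ w in Ioi (1 : ℝ),
        H s w ^ k * Real.exp (-(H s w)) * (β * w ^ (-β - 1))) - s * J s‖ ≤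
        e s * (s * J s) + 2 * D / s := by
    filter_upwards [hH, eventually_gt_atTop 1, hLtop.eventually_ge_atTop 1,
      hdiv.eventually (lt_mem_nhds (show (1 / 2 : ℝ) < 1 by norm_num)),
      hεM.eventually (gt_mem_nhds (show (0 : ℝ) < 1 by norm_num)),
      Real.tendsto_log_atTop.eventually_ge_atTop 1] with s ⟨hε0, hmono, hpos, hup, hlow⟩ hs hL1 hLd hεs hls
    have hs0 : 0 < s := by linarith
    have hL2 : Real.log s / 2 ≤ L s := by
      rw [lt_div_iff₀ (by linarith)] at hLd; linarith
    have hee : 0 ≤ e s := by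
      have h1 : 0 ≤ ε s * M := by positivity
      have ha : 1 ≤ Real.exp (ε s * M) := Real.one_le_exp h1
      have hb : (1 - ε s * M) ^ k ≤ 1 := pow_le_one₀ (by linarith) (by linarith)
      simp only [he]; linarith
    have hsm : ∀ y : ℝ, 4 * Real.log s ≤ y → y ^ k * Real.exp (-y) ≤ D / s ^ 2 := by
      intro y hy
      have h1 := aux_pow_exp k y (by linarith)
      have h2 : Real.exp (-(y / 2)) ≤ 1 / s ^ 2 := by
        have : -(y / 2) ≤ -(2 * Real.log s) := by linarith
        refine (Real.exp_le_exp.mpr this).trans (le_of_eq ?_)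
        rw [Real.exp_neg, mul_comm, Real.exp_mul, Real.exp_log hs0]
        norm_num
      calc _ ≤ D * Real.exp (-(y / 2)) := h1
        _ ≤ D * (1 / s ^ 2) := by gcongr
        _ = _ := by ring
    have hgen : ∀ y : ℝ, 0 ≤ y → y ^ k * Real.exp (-y) ≤ D := by
      intro y hy
      have h1 := aux_pow_exp k y hy
      have h2 : Real.exp (-(y / 2)) ≤ 1 := by rw [Real.exp_le_one_iff]; linarith
      calc _ ≤ D * Real.exp (-(y / 2)) := h1
        _ ≤ D * 1 := by gcongr
        _ = _ := by ring
    have hpt : ∀ w ∈ Ioi (1 : ℝ), |H s w ^ k * Real.exp (-(H s w)) -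
        (L s * w ^ δ) ^ k * Real.exp (-(L s * w ^ δ))| ≤
        e s * ((L s * w ^ δ) ^ k * Real.exp (-(L s * w ^ δ))) + 2 * D / s ^ 2 := by
      intro w hw
      have hw1 : 1 < w := hw
      have hwδ : 1 < w ^ δ := Real.one_lt_rpow hw1 hδ
      have hx1 : 1 ≤ L s * w ^ δ := by nlinarith
      rcases le_total w M with hwM | hwM
      · have h1 := aux_cmp k (L s * w ^ δ) (H s w) (ε s * M) hx1 (by positivity) hεs.le
          (by have := mul_le_mul_of_nonneg_left hwM hε0
              linarith [hlow w hw]) (hup w hw)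
        have : 0 ≤ 2 * D / s ^ 2 := by positivity
        simp only [he]
        linarith
      · have h1 := hmono (show M ∈ Ioi 1 from hM1) hw hwM
        have h2 := hlow M hM1
        rw [hMδ] at h2
        have h3 : 4 * Real.log s ≤ H s w := by linarith
        have h4 := hsm _ h3
        have h5 := hsm _ (h3.trans (hup w hw))
        have h6 : 0 ≤ H s w ^ k * Real.exp (-(H s w)) :=
          mul_nonneg (pow_nonneg (hpos w hw) _) (Real.exp_pos _).le
        have h7 : 0 ≤ (L s * w ^ δ) ^ k * Real.exp (-(L s * w ^ δ)) := by positivity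
        have h8 := mul_nonneg hee h7
        have h9 : 2 * D / s ^ 2 = D / s ^ 2 + D / s ^ 2 := by ring
        rw [abs_le]
        constructor <;> linarith
    have hmH : AEMeasurable (H s) (volume.restrict (Ioi 1)) :=
      aemeasurable_restrict_of_monotoneOn measurableSet_Ioi hmono
    have hIntOf : ∀ f : ℝ → ℝ, AEMeasurable f (volume.restrict (Ioi 1)) → (∀ w ∈ Ioi (1 : ℝ), 0 ≤ f w) →
        IntegrableOn (fun w => f w ^ k * Real.exp (-(f w)) * (β * w ^ (-β - 1))) (Ioi 1) := by
      intro f hf hf0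
      refine Integrable.mono' (hpar.1.const_mul D) ?_ ?_
      · apply AEMeasurable.aestronglyMeasurable
        have : AEMeasurable (fun w : ℝ => β * w ^ (-β - 1)) (volume.restrict (Ioi 1)) :=
          Measurable.aemeasurable (by fun_prop)
        exact ((hf.pow_const k).mul hf.neg.exp).mul this
      · filter_upwards [ae_restrict_mem measurableSet_Ioi] with w hw
        have hw1 : (0 : ℝ) < w := lt_trans one_pos hw
        have h0 := hf0 w hw
        rw [Real.norm_of_nonneg (by positivity)]
        exact mul_le_mul_of_nonneg_right (hgen _ h0) (by positivity)
    have hi1 := hIntOf (H s) hmH hpos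
    have hi2 := hIntOf (fun w => L s * w ^ δ) (Measurable.aemeasurable (by fun_prop)) (by
      intro w hw
      have hw1 : (0 : ℝ) < w := lt_trans one_pos hw
      have : 0 < L s := by linarith
      positivity)
    rw [← mul_sub]
    change ‖s * ((∫ w in Ioi (1 : ℝ), H s w ^ k * Real.exp (-(H s w)) * (β * w ^ (-β - 1))) -
      ∫ w in Ioi (1 : ℝ),
      (L s * w ^ δ) ^ k * Real.exp (-(L s * w ^ δ)) * (β * w ^ (-β - 1)))‖ ≤ _
    rw [← integral_sub hi1 hi2, norm_mul, Real.norm_of_nonneg hs0.le]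
    have hfin : ‖∫ w in Ioi (1 : ℝ), (H s w ^ k * Real.exp (-(H s w)) * (β * w ^ (-β - 1)) -
        (L s * w ^ δ) ^ k * Real.exp (-(L s * w ^ δ)) * (β * w ^ (-β - 1)))‖ ≤
        ∫ w in Ioi (1 : ℝ), (e s * ((L s * w ^ δ) ^ k * Real.exp (-(L s * w ^ δ)) * (β * w ^ (-β - 1)))
          + 2 * D / s ^ 2 * (β * w ^ (-β - 1))) := by
      apply norm_integral_le_of_norm_le ((hi2.const_mul _).add (hpar.1.const_mul _))
      filter_upwards [ae_restrict_mem measurableSet_Ioi] with w hw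
      have hw1 : (0 : ℝ) < w := lt_trans one_pos hw
      have hc : 0 ≤ β * w ^ (-β - 1) := by positivity
      rw [← sub_mul, norm_mul, Real.norm_of_nonneg hc, Real.norm_eq_abs]
      refine (mul_le_mul_of_nonneg_right (hpt w hw) hc).trans (le_of_eq ?_)
      simp only [Pi.add_apply]
      ring
    rw [integral_add (hi2.const_mul _) (hpar.1.const_mul _), integral_const_mul, integral_const_mul,
      hpar.2, mul_one] at hfin
    calc _ ≤ s * _ := mul_le_mul_of_nonneg_left hfin hs0.le
      _ = _ := by
        change s * (e s * J s + 2 * D / s ^ 2) = _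
        field_simp
  have hz : Tendsto (fun s => e s * (s * J s) + 2 * D / s) atTop (nhds 0) := by
    have h1 := he0.mul hJlim
    have h2 : Tendsto (fun s : ℝ => 2 * D / s) atTop (nhds 0) :=
      tendsto_const_nhds.div_atTop tendsto_id
    simpa using h1.add h2
  have h := squeeze_zero_norm' hbound hz
  have := h.add hJlim
  simpa using this

lemma aux_eps (k : ℕ) (A p c : ℝ) (hp : 1 < p) (hc : 0 < c) (L : ℝ → ℝ)
    (hL : ∀ s, L s = Real.log s + ((k : ℝ) - 1) * Real.log (Real.log s) + A) :
    Tendsto (fun s => s * (1 / (c * s) * L s) ^ p) atTop (nhds 0) := by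
  have hdiv : Tendsto (fun s => L s / Real.log s) atTop (nhds 1) := by
    simp_rw [hL]; exact aux_L_div k A
  have hq : 0 < 1 - 1 / p := by
    have : 1 / p < 1 := by rw [div_lt_one (by linarith)]; exact hp
    linarith
  have h1 := (isLittleO_log_rpow_atTop hq).tendsto_div_nhds_zero
  have h2 := (hdiv.mul h1).mul_const (1 / c)
  have h3 := h2.rpow_const (p := p) (Or.inr (by linarith))
  simp only [mul_zero, zero_mul] at h3
  rw [Real.zero_rpow (by linarith)] at h3
  refine h3.congr' ?_
  filter_upwards [eventually_gt_atTop 1, hdiv.eventually (lt_mem_nhds one_pos)] with s hs hLs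
  have hl := Real.log_pos hs
  have hs0 : 0 < s := by linarith
  have hLp : 0 < L s := by
    have := mul_pos hLs hl
    rwa [div_mul_cancel₀ _ hl.ne'] at this
  have e1 : s = (s ^ (1 / p)) ^ p := by
    rw [← Real.rpow_mul hs0.le, one_div_mul_cancel (by linarith), Real.rpow_one]
  have e2 : L s / Real.log s * (Real.log s / s ^ (1 - 1 / p)) * (1 / c) =
      s ^ (1 / p) * (1 / (c * s) * L s) := by
    rw [Real.rpow_sub hs0, Real.rpow_one]
    field_simp
  rw [e2, Real.mul_rpow (by positivity) (by positivity), ← e1]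

theorem expected_degree_k_count_tendsto
    (d k : ℕ) (hd : 1 ≤ d) (α β η ξ : ℝ)
    (hα : 0 < α) (hβ : 0 < β) (hη : 0 < η)
    (hαd : (d : ℝ) < α) (hβ1 : 1 < β)
    (c₀ : ℝ)
    (hc₀ : c₀ = (volume (Metric.closedBall (0 : EuclideanSpace ℝ (Fin d)) 1)).toReal *
      (α * β / (α * β - d)) * η ^ ((d : ℝ) / α) * Real.Gamma (1 - (d : ℝ) / α))
    (r : ℝ → ℝ)
    (hr : ∀ᶠ s in atTop, 0 < r s ∧
      r s ^ d = (1 / (c₀ * s)) *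
        (Real.log s + ((k : ℝ) - 1) * Real.log (Real.log s) + ξ +
          Real.log (α * β / ((k.factorial : ℝ) * d))))
    (G : ℝ → ℝ → ℝ)
    (hG : ∀ s w₀, G s w₀ =
      ∫ x in {x : EuclideanSpace ℝ (Fin d) | ∀ i, x i ∈ Ioc (-(1 : ℝ) / 2) (1 / 2)},
        ∫ w in Ioi (1 : ℝ),
          (1 - Real.exp (-(η * w₀ * w * r s ^ α / ‖x‖ ^ α))) * (β * w ^ (-β - 1))) :
    Tendsto (fun s : ℝ =>
        (s / (k.factorial : ℝ)) *
          ∫ w₀ in Ioi (1 : ℝ),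
            (s * G s w₀) ^ k * Real.exp (-(s * G s w₀)) * (β * w₀ ^ (-β - 1)))
      atTop (nhds (Real.exp (-ξ))) := by
  have hd0 : (0 : ℝ) < d := by exact_mod_cast hd
  have hδ0 : 0 < (d : ℝ) / α := by positivity
  have hδ : (d : ℝ) / α < 1 := by rw [div_lt_one hα]; exact hαd
  have hGa : 0 < Real.Gamma (1 - (d : ℝ) / α) := Real.Gamma_pos_of_pos (by linarith)
  have hb : 0 < β - d / α := by linarith
  have hθ : 0 < (volume (Metric.closedBall (0 : EuclideanSpace ℝ (Fin d)) 1)).toReal :=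
    ENNReal.toReal_pos (Metric.measure_closedBall_pos _ _ one_pos).ne'
      measure_closedBall_lt_top.ne
  have hab : α * β / (α * β - d) = β / (β - d / α) := by
    have h1 : α * β - d = α * (β - d / α) := by field_simp
    rw [h1, mul_div_mul_left _ _ hα.ne']
  rw [hab] at hc₀
  have hc0 : 0 < c₀ := by rw [hc₀]; positivity
  obtain ⟨C, hC0, hC⟩ := aux_core d hd α β hαd hβ1
  set A : ℝ := ξ + Real.log (α * β / ((k.factorial : ℝ) * d)) with hA
  set L : ℝ → ℝ := fun s => Real.log s + ((k : ℝ) - 1) * Real.log (Real.log s) + A with hL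
  have hGK : ∀ s w₀, G s w₀ =
      ∫ x in {x : EuclideanSpace ℝ (Fin d) | ∀ i, x i ∈ Ioc (-(1 : ℝ) / 2) (1 / 2)},
        auxK d α β (η * w₀ * r s ^ α) x := by
    intro s w₀
    rw [hG]
    unfold auxK
    have : ∀ w : ℝ, η * w₀ * w * r s ^ α = η * w₀ * r s ^ α * w := fun w => by ring
    simp_rw [this]
  have hr' : ∀ᶠ s in atTop, 0 < r s ∧ r s ^ d = 1 / (c₀ * s) * L s := by
    filter_upwards [hr] with s hs
    refine ⟨hs.1, ?_⟩
    rw [hs.2, hL, hA]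
    ring
  have hp : 1 < α / d := by rw [one_lt_div hd0]; exact hαd
  have hrα : ∀ s, 0 < r s → r s ^ d = 1 / (c₀ * s) * L s →
      r s ^ α = (1 / (c₀ * s) * L s) ^ (α / d) := by
    intro s h1 h2
    rw [← h2, ← Real.rpow_natCast, ← Real.rpow_mul h1.le]
    congr 1
    field_simp
  have hmain := aux_asym k ((d : ℝ) / α) β A hδ0 hβ L
    (fun s => (C * η) * (s * (1 / (c₀ * s) * L s) ^ (α / d))) (fun s w => s * G s w)
    (fun s => rfl)
    (by simpa using (aux_eps k A (α / d) c₀ hp hc0 L (fun s => rfl)).const_mul (C * η))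
    (by
      filter_upwards [hr', eventually_gt_atTop 0] with s ⟨hr0, hrd⟩ hs
      have hra := hrα s hr0 hrd
      have hra0 : 0 < r s ^ α := by positivity
      rw [← hra]
      have hval : ∀ w : ℝ, 1 < w →
          s * ((volume (Metric.closedBall (0 : EuclideanSpace ℝ (Fin d)) 1)).toReal *
          (β / (β - d / α)) * Real.Gamma (1 - (d : ℝ) / α) *
          (η * w * r s ^ α) ^ ((d : ℝ) / α)) = L s * w ^ ((d : ℝ) / α) := by
        intro w hw
        have hw0 : 0 < w := by linarith
        rw [Real.mul_rpow (by positivity) hra0.le, Real.mul_rpow hη.le hw0.le,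
          ← Real.rpow_mul hr0.le, mul_div_cancel₀ _ hα.ne', Real.rpow_natCast, hrd]
        calc _ = s * (c₀ * w ^ ((d : ℝ) / α) * (1 / (c₀ * s) * L s)) := by rw [hc₀]; ring
          _ = _ := by field_simp
      refine ⟨by positivity, ?_, ?_, ?_, ?_⟩
      · intro u hu v hv huv
        have hu0 : (0 : ℝ) < u := lt_trans one_pos hu
        have hv0 : (0 : ℝ) < v := lt_trans one_pos hv
        apply mul_le_mul_of_nonneg_left _ hs.le
        rw [hGK, hGK]
        apply integral_mono
        · exact (auxK_integrable d hd α β _ hαd hβ1 (by positivity)).integrableOn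
        · exact (auxK_integrable d hd α β _ hαd hβ1 (by positivity)).integrableOn
        · intro x
          apply auxK_mono d α β _ _ hβ1 (by positivity)
          gcongr
      · intro w hw
        have hw0 : (0 : ℝ) < w := lt_trans one_pos hw
        apply mul_nonneg hs.le
        rw [hGK]
        exact integral_nonneg (fun x => auxK_nonneg d α β _ hβ (by positivity) x)
      · intro w hw
        have hw0 : (0 : ℝ) < w := lt_trans one_pos hw
        rw [← hval w hw, hGK]
        exact mul_le_mul_of_nonneg_left (hC _ (by positivity)).1 hs.le
      · intro w hw
        have hw0 : (0 : ℝ) < w := lt_trans one_pos hw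
        rw [← hval w hw, hGK]
        have h1 := mul_le_mul_of_nonneg_left (hC (η * w * r s ^ α) (by positivity)).2 hs.le
        refine le_trans (le_of_eq ?_) h1
        ring)
  have hfin := hmain.mul_const (1 / (k.factorial : ℝ))
  have hk : (0 : ℝ) < k.factorial := by positivity
  have hlim : Real.exp (-A) * (β / (d / α)) * (1 / (k.factorial : ℝ)) = Real.exp (-ξ) := by
    rw [hA, neg_add, Real.exp_add, Real.exp_neg (Real.log _), Real.exp_log (by positivity)]
    field_simp
  rw [hlim] at hfin
  refine hfin.congr (fun s => ?_)
  ring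
end

section
/- Let d ≥ 1 be an integer and let α, β, η > 0 satisfy α > d and β > 1. Set c₀ := θ_d · (αβ/(αβ − d)) · η^{d/α} · Γ(1 − d/α) and c₃ := θ_d · α · η · β² · 2^{α−d} / ((β−1)(α−d)). Then for every w₀ ≥ 1 and every r > 0, with D_r := (−1/(2r), 1/(2r)]^d, max(0, c₀ w₀^{d/α} − c₃ w₀ r^{α−d}) ≤ ∫_{D_r} ∫₁^∞ (1 − exp(−η w₀ w / ‖x‖^α)) β w^{−β−1} dw dx ≤ c₀ w₀^{d/α}. -/
open MeasureTheory Set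

/-- `1 - exp (-a)` as an integral of the exponential density. -/
lemma smd_exp_lintegral (a : ℝ) (ha : 0 ≤ a) :
    ENNReal.ofReal (1 - Real.exp (-a)) = ∫⁻ t in Ioc 0 a, ENNReal.ofReal (Real.exp (-t)) := by
  have hint : IntegrableOn (fun t : ℝ => Real.exp (-t)) (Ioc 0 a) :=
    (Continuous.integrableOn_Icc (by fun_prop)).mono_set Ioc_subset_Icc_self
  rw [← ofReal_integral_eq_lintegral_ofReal hint
    (Filter.Eventually.of_forall fun t => (Real.exp_pos _).le)]
  congr 1
  rw [← intervalIntegral.integral_of_le ha]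
  have := intervalIntegral.integral_eq_sub_of_hasDerivAt (a := 0) (b := a)
    (f := fun t => - Real.exp (-t)) (f' := fun t => Real.exp (-t))
    (fun x _ => by
      have h := ((hasDerivAt_neg x).exp).neg
      exact h.congr_deriv (by simp)) (Continuous.intervalIntegrable (by fun_prop) _ _)
  rw [this]; simp; ring

/-- The integral over all space for a fixed weight. -/
lemma smd_space_lintegral (d : ℕ) (hd : 1 ≤ d) (α c : ℝ) (hα : 0 < α) (hαd : (d : ℝ) < α)
    (hc : 0 < c) :
    ∫⁻ x : EuclideanSpace ℝ (Fin d), ENNReal.ofReal (1 - Real.exp (-(c / ‖x‖ ^ α))) =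
      ENNReal.ofReal ((volume (Metric.closedBall (0 : EuclideanSpace ℝ (Fin d)) 1)).toReal *
        c ^ ((d : ℝ) / α) * Real.Gamma (1 - (d : ℝ) / α)) := by
  have : Nonempty (Fin d) := ⟨⟨0, hd⟩⟩
  have hs : 0 < 1 - (d : ℝ) / α := by
    have : (d : ℝ) / α < 1 := (div_lt_one hα).2 hαd
    linarith
  set θ := volume (Metric.closedBall (0 : EuclideanSpace ℝ (Fin d)) 1) with hθ
  have hθtop : θ ≠ ⊤ := measure_closedBall_lt_top.ne
  let S : Set (EuclideanSpace ℝ (Fin d) × ℝ) := {p | p.2 * ‖p.1‖ ^ α ≤ c}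
  have hS : MeasurableSet S := measurableSet_le (by fun_prop) (by fun_prop)
  let F : EuclideanSpace ℝ (Fin d) → ℝ → ENNReal := fun x t =>
    S.indicator (fun p => ENNReal.ofReal (Real.exp (-p.2))) (x, t)
  have hF : Measurable (Function.uncurry F) := by
    have : Function.uncurry F = S.indicator (fun p => ENNReal.ofReal (Real.exp (-p.2))) := by
      ext ⟨x, t⟩; rfl
    rw [this]
    exact Measurable.indicator (by fun_prop) hS
  have h1 : ∫⁻ x : EuclideanSpace ℝ (Fin d), ENNReal.ofReal (1 - Real.exp (-(c / ‖x‖ ^ α))) =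
      ∫⁻ x : EuclideanSpace ℝ (Fin d), ∫⁻ t in Ioi 0, F x t := by
    apply lintegral_congr_ae
    have h0 : ∀ᵐ x : EuclideanSpace ℝ (Fin d), x ≠ 0 := by
      simp [ae_iff]
    filter_upwards [h0] with x hx
    have hn : 0 < ‖x‖ ^ α := Real.rpow_pos_of_pos (norm_pos_iff.2 hx) _
    rw [smd_exp_lintegral _ (by positivity)]
    have : Ioc 0 (c / ‖x‖ ^ α) = Iic (c / ‖x‖ ^ α) ∩ Ioi 0 := by
      ext t; simp [and_comm]
    rw [this, ← Measure.restrict_restrict measurableSet_Iic,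
      ← lintegral_indicator measurableSet_Iic]
    apply lintegral_congr
    intro t
    simp only [F, S, indicator, mem_Iic, mem_ofPred_eq, le_div_iff₀ hn]
  rw [h1, lintegral_lintegral_swap hF.aemeasurable]
  have h2 : ∀ t ∈ Ioi (0 : ℝ), ∫⁻ x, F x t =
      θ * ENNReal.ofReal (c ^ ((d : ℝ) / α)) *
        ENNReal.ofReal (Real.exp (-t) * t ^ ((1 - (d : ℝ) / α) - 1)) := by
    intro t ht
    have ht : 0 < t := ht
    have hrad : 0 ≤ (c / t) ^ (1 / α) := by positivity
    have hset : ∀ x : EuclideanSpace ℝ (Fin d), F x t =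
        (Metric.closedBall (0 : EuclideanSpace ℝ (Fin d)) ((c / t) ^ (1 / α))).indicator
          (fun _ => ENNReal.ofReal (Real.exp (-t))) x := by
      intro x
      have : t * ‖x‖ ^ α ≤ c ↔ ‖x‖ ≤ (c / t) ^ (1 / α) := by
        rw [mul_comm, ← le_div_iff₀ ht, one_div,
          Real.le_rpow_inv_iff_of_pos (norm_nonneg _) (by positivity) hα]
      simp only [F, S, indicator, mem_ofPred_eq, this, mem_closedBall_zero_iff]
    simp_rw [hset]
    rw [lintegral_indicator_const measurableSet_closedBall, Measure.addHaar_closedBall' _ _ hrad,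
      finrank_euclideanSpace_fin]
    have : ((c / t) ^ (1 / α)) ^ d = c ^ ((d : ℝ) / α) * t ^ ((1 - (d : ℝ) / α) - 1) := by
      rw [← Real.rpow_natCast, ← Real.rpow_mul (by positivity), Real.div_rpow hc.le ht.le,
        div_eq_mul_inv, ← Real.rpow_neg ht.le]
      congr 2 <;> ring
    rw [this, ENNReal.ofReal_mul (by positivity), ENNReal.ofReal_mul (by positivity)]
    ring
  rw [setLIntegral_congr_fun measurableSet_Ioi h2, lintegral_const_mul _ (by fun_prop),
    ← ofReal_integral_eq_lintegral_ofReal (Real.GammaIntegral_convergent hs), 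
    ← Real.Gamma_eq_integral hs, ENNReal.ofReal_mul (by positivity),
    ENNReal.ofReal_mul (by positivity), ENNReal.ofReal_toReal hθtop]
  filter_upwards [ae_restrict_mem measurableSet_Ioi] with t ht
  have ht : 0 < t := ht
  exact (by positivity : 0 ≤ Real.exp (-t) * t ^ ((1 - (d : ℝ) / α) - 1))

/-- Pareto moments. -/
lemma smd_pareto (β p : ℝ) (hβ : 0 < β) (hp : p < β) :
    ∫⁻ w in Ioi (1 : ℝ), ENNReal.ofReal (w ^ p * (β * w ^ (-β - 1))) =
      ENNReal.ofReal (β / (β - p)) := by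
  have h : ∀ w ∈ Ioi (1 : ℝ), ENNReal.ofReal (w ^ p * (β * w ^ (-β - 1))) =
      ENNReal.ofReal (β * w ^ (p - β - 1)) := by
    intro w hw
    have hw : 0 < w := zero_lt_one.trans hw
    congr 1
    rw [show p - β - 1 = p + (-β - 1) by ring, Real.rpow_add hw]; ring
  rw [setLIntegral_congr_fun measurableSet_Ioi h, ← ofReal_integral_eq_lintegral_ofReal, 
    integral_const_mul, integral_Ioi_rpow_of_lt (by linarith) one_pos]
  · congr 1
    have : β - p ≠ 0 := by linarith
    have h' : p - β - 1 + 1 ≠ 0 := by intro h; apply this; linarith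
    rw [Real.one_rpow]; field_simp; ring
  · exact (integrableOn_Ioi_rpow_of_lt (by linarith) one_pos).const_mul _
  · filter_upwards [ae_restrict_mem measurableSet_Ioi] with t ht
    have ht : 0 < t := zero_lt_one.trans ht
    exact (by positivity : 0 ≤ β * t ^ (p - β - 1))

/-- The tail of `‖x‖ ^ (-α)`. -/
lemma smd_tail (d : ℕ) (hd : 1 ≤ d) (α R : ℝ) (hαd : (d : ℝ) < α) (hR : 0 < R) :
    ∫⁻ x in {x : EuclideanSpace ℝ (Fin d) | R ≤ ‖x‖}, ENNReal.ofReal (‖x‖ ^ (-α)) =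
      ENNReal.ofReal ((volume (Metric.closedBall (0 : EuclideanSpace ℝ (Fin d)) 1)).toReal *
        d * (R ^ ((d : ℝ) - α) / (α - d))) := by
  have : Nonempty (Fin d) := ⟨⟨0, hd⟩⟩
  let f : ℝ → ℝ := (Ici R).indicator fun y => y ^ (-α)
  have hmS : MeasurableSet {x : EuclideanSpace ℝ (Fin d) | R ≤ ‖x‖} :=
    measurableSet_le (by fun_prop) (by fun_prop)
  have hf : ∀ y : ℝ, y ^ (d - 1) • f y = (Ici R).indicator (fun y => y ^ ((d : ℝ) - 1 - α)) y := by
    intro y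
    by_cases hy : y ∈ Ici R
    · have hy0 : 0 < y := hR.trans_le hy
      simp only [f, indicator_of_mem hy, smul_eq_mul]
      rw [← Real.rpow_natCast, ← Real.rpow_add hy0, Nat.cast_sub hd]
      congr 1; push_cast; ring
    · simp [f, indicator_of_notMem hy]
  have hsub : Ici R ∩ Ioi 0 = Ici R := inter_eq_left.2 fun y hy => hR.trans_le hy
  have hi0 : IntegrableOn (fun y : ℝ => y ^ ((d : ℝ) - 1 - α)) (Ioi R) :=
    integrableOn_Ioi_rpow_of_lt (by linarith) hR
  have hint : Integrable (fun x : EuclideanSpace ℝ (Fin d) => f ‖x‖) := by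
    rw [integrable_fun_norm_addHaar, finrank_euclideanSpace_fin]
    simp_rw [hf]
    rw [IntegrableOn, integrable_indicator_iff measurableSet_Ici, IntegrableOn, 
      Measure.restrict_restrict measurableSet_Ici, hsub]
    exact (integrableOn_Ici_iff_integrableOn_Ioi (by simp)).2 hi0
  have h1 : ∫⁻ x in {x : EuclideanSpace ℝ (Fin d) | R ≤ ‖x‖}, ENNReal.ofReal (‖x‖ ^ (-α)) =
      ∫⁻ x : EuclideanSpace ℝ (Fin d), ENNReal.ofReal (f ‖x‖) := by
    rw [← lintegral_indicator hmS]
    apply lintegral_congr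
    intro x
    by_cases hx : R ≤ ‖x‖ <;> simp [f, indicator, hx]
  rw [h1, ← ofReal_integral_eq_lintegral_ofReal hint, integral_fun_norm_addHaar,
    finrank_euclideanSpace_fin]
  · simp_rw [hf]
    rw [setIntegral_indicator measurableSet_Ici, inter_comm, hsub, integral_Ici_eq_integral_Ioi,
      integral_Ioi_rpow_of_lt (by linarith) hR, Measure.real, Measure.addHaar_closedBall_eq_addHaar_ball]
    congr 1
    rw [show (d : ℝ) - 1 - α + 1 = -(α - d) by ring, neg_div_neg_eq, neg_sub]
    simp only [nsmul_eq_mul, smul_eq_mul]; ring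
  · refine Filter.Eventually.of_forall fun x => ?_
    exact indicator_nonneg (fun y hy => Real.rpow_nonneg (hR.le.trans hy) _) _

theorem scaled_mean_degree_sandwich
    (d : ℕ) (hd : 1 ≤ d) (α β η : ℝ)
    (hα : 0 < α) (hβ : 0 < β) (hη : 0 < η)
    (hαd : (d : ℝ) < α) (hβ1 : 1 < β)
    (c₀ c₃ : ℝ)
    (hc₀ : c₀ = (volume (Metric.closedBall (0 : EuclideanSpace ℝ (Fin d)) 1)).toReal *
      (α * β / (α * β - d)) * η ^ ((d : ℝ) / α) * Real.Gamma (1 - (d : ℝ) / α))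
    (hc₃ : c₃ = (volume (Metric.closedBall (0 : EuclideanSpace ℝ (Fin d)) 1)).toReal *
      α * η * β ^ 2 * 2 ^ (α - (d : ℝ)) / ((β - 1) * (α - d)))
    (w₀ r : ℝ) (hw₀ : 1 ≤ w₀) (hr : 0 < r) :
    max 0 (c₀ * w₀ ^ ((d : ℝ) / α) - c₃ * w₀ * r ^ (α - (d : ℝ))) ≤
      (∫ x in {x : EuclideanSpace ℝ (Fin d) |
            ∀ i, x i ∈ Ioc (-(1 / (2 * r))) (1 / (2 * r))},
          ∫ w in Ioi (1 : ℝ),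
            (1 - Real.exp (-(η * w₀ * w / ‖x‖ ^ α))) * (β * w ^ (-β - 1))) ∧
    (∫ x in {x : EuclideanSpace ℝ (Fin d) |
            ∀ i, x i ∈ Ioc (-(1 / (2 * r))) (1 / (2 * r))},
          ∫ w in Ioi (1 : ℝ),
            (1 - Real.exp (-(η * w₀ * w / ‖x‖ ^ α))) * (β * w ^ (-β - 1))) ≤
      c₀ * w₀ ^ ((d : ℝ) / α) := by
  have hs : (d : ℝ) / α < 1 := (div_lt_one hα).2 hαd
  have hw0 : 0 < w₀ := by linarith
  have hΓ : 0 < Real.Gamma (1 - (d : ℝ) / α) := Real.Gamma_pos_of_pos (by linarith)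
  set D : Set (EuclideanSpace ℝ (Fin d)) :=
    {x | ∀ i, x i ∈ Ioc (-(1 / (2 * r))) (1 / (2 * r))} with hD
  have hDm : MeasurableSet D := by
    have : D = ⋂ i, (fun x : EuclideanSpace ℝ (Fin d) => x i) ⁻¹'
        Ioc (-(1 / (2 * r))) (1 / (2 * r)) := by
      ext x; simp [hD]
    rw [this]
    exact MeasurableSet.iInter fun i => measurableSet_Ioc.preimage (by fun_prop)
  set θ := (volume (Metric.closedBall (0 : EuclideanSpace ℝ (Fin d)) 1)).toReal with hθ
  have hθ0 : 0 ≤ θ := ENNReal.toReal_nonneg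
  let K : EuclideanSpace ℝ (Fin d) → ℝ → ℝ := fun x w =>
    (1 - Real.exp (-(η * w₀ * w / ‖x‖ ^ α))) * (β * w ^ (-β - 1))
  have hKm : Measurable (Function.uncurry K) := by
    simp only [K, Function.uncurry_def]; fun_prop
  have hK1 : ∀ (x : EuclideanSpace ℝ (Fin d)) (w : ℝ), w ∈ Ioi (1 : ℝ) →
      0 ≤ 1 - Real.exp (-(η * w₀ * w / ‖x‖ ^ α)) := by
    intro x w hw
    have hw : 0 < w := zero_lt_one.trans hw
    have h : 0 ≤ η * w₀ * w / ‖x‖ ^ α := by positivity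
    have := Real.exp_le_one_iff.2 (neg_nonpos.2 h)
    linarith
  have hK0 : ∀ (x : EuclideanSpace ℝ (Fin d)) (w : ℝ), w ∈ Ioi (1 : ℝ) → 0 ≤ K x w := by
    intro x w hw
    have h := hK1 x w hw
    have hw : 0 < w := zero_lt_one.trans hw
    exact mul_nonneg h (by positivity)
  let L : EuclideanSpace ℝ (Fin d) → ENNReal := fun x => ∫⁻ w in Ioi (1 : ℝ), ENNReal.ofReal (K x w)
  have hKm' : Measurable (Function.uncurry fun x w => ENNReal.ofReal (K x w)) :=
    hKm.ennreal_ofReal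
  have hLm : Measurable L := Measurable.lintegral_prod_right' hKm'
  have hinner : ∀ x, ∫ w in Ioi (1 : ℝ), K x w = (L x).toReal := by
    intro x
    rw [integral_eq_lintegral_of_nonneg_ae]
    · filter_upwards [ae_restrict_mem measurableSet_Ioi] with w hw using hK0 x w hw
    · exact (hKm.comp measurable_prodMk_left).aestronglyMeasurable
  -- total mass
  have htot : ∫⁻ x, L x = ENNReal.ofReal (c₀ * w₀ ^ ((d : ℝ) / α)) := by
    simp only [L]
    rw [lintegral_lintegral_swap hKm'.aemeasurable]
    have h2 : ∀ w ∈ Ioi (1 : ℝ), ∫⁻ x, ENNReal.ofReal (K x w) =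
        ENNReal.ofReal (θ * (η * w₀) ^ ((d : ℝ) / α) * Real.Gamma (1 - (d : ℝ) / α)) *
          ENNReal.ofReal (w ^ ((d : ℝ) / α) * (β * w ^ (-β - 1))) := by
      intro w hw'
      have hw : 0 < w := zero_lt_one.trans hw'
      simp only [K]
      simp_rw [fun x => ENNReal.ofReal_mul (q := β * w ^ (-β - 1)) (hK1 x w hw')]
      rw [lintegral_mul_const _ (by fun_prop),
        smd_space_lintegral d hd α (η * w₀ * w) hα hαd (by positivity),
        ← ENNReal.ofReal_mul (by positivity), ← ENNReal.ofReal_mul (by positivity)]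
      congr 1
      rw [Real.mul_rpow (by positivity) hw.le]; ring
    rw [setLIntegral_congr_fun measurableSet_Ioi h2, lintegral_const_mul _ (by fun_prop),
      smd_pareto β _ hβ (by linarith), ← ENNReal.ofReal_mul (by positivity)]
    congr 1
    have hne : α * β - d ≠ 0 := by nlinarith
    have hne' : β - (d : ℝ) / α ≠ 0 := by linarith
    have : β / (β - (d : ℝ) / α) = α * β / (α * β - d) := by
      rw [div_eq_div_iff hne' hne]; field_simp
    rw [hc₀, this, Real.mul_rpow hη.le hw0.le]; ring
  -- tail bound
  have hR : 0 < 1 / (2 * r) := by positivity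
  have hDc : Dᶜ ⊆ {x : EuclideanSpace ℝ (Fin d) | 1 / (2 * r) ≤ ‖x‖} := by
    intro x hx
    simp only [hD, mem_compl_iff, mem_ofPred_eq, not_forall] at hx
    obtain ⟨i, hi⟩ := hx
    have h1 : |x i| ≤ ‖x‖ := by simpa using PiLp.norm_apply_le x i
    refine le_trans ?_ h1
    by_contra! h
    rw [abs_lt] at h
    exact hi ⟨h.1, h.2.le⟩
  have hLb : ∀ x ∈ {x : EuclideanSpace ℝ (Fin d) | 1 / (2 * r) ≤ ‖x‖},
      L x ≤ ENNReal.ofReal (η * w₀ * (β / (β - 1))) * ENNReal.ofReal (‖x‖ ^ (-α)) := by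
    intro x hx
    have hx : 0 < ‖x‖ := hR.trans_le hx
    have hb : 0 < β - 1 := by linarith
    calc L x ≤ ∫⁻ w in Ioi (1 : ℝ), ENNReal.ofReal (η * w₀ * ‖x‖ ^ (-α)) *
          ENNReal.ofReal (w ^ (1 : ℝ) * (β * w ^ (-β - 1))) := by
          apply setLIntegral_mono (by fun_prop)
          intro w hw
          have hw : 0 < w := zero_lt_one.trans hw
          rw [← ENNReal.ofReal_mul (by positivity)]
          apply ENNReal.ofReal_le_ofReal
          have h := Real.add_one_le_exp (-(η * w₀ * w / ‖x‖ ^ α))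
          have h' : 1 - Real.exp (-(η * w₀ * w / ‖x‖ ^ α)) ≤ η * w₀ * w / ‖x‖ ^ α := by linarith
          calc K x w ≤ η * w₀ * w / ‖x‖ ^ α * (β * w ^ (-β - 1)) :=
                mul_le_mul_of_nonneg_right h' (by positivity)
            _ = _ := by rw [Real.rpow_neg hx.le, Real.rpow_one]; ring
      _ = _ := by
          rw [lintegral_const_mul _ (by fun_prop), smd_pareto β 1 hβ hβ1,
            ← ENNReal.ofReal_mul (by positivity), ← ENNReal.ofReal_mul (by positivity)]
          congr 1; ring
  have hc3n : 0 ≤ c₃ * w₀ * r ^ (α - (d : ℝ)) := by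
    have hb : 0 < β - 1 := by linarith
    have ha : 0 < α - d := by linarith
    rw [hc₃]; positivity
  have htail : ∫⁻ x in Dᶜ, L x ≤ ENNReal.ofReal (c₃ * w₀ * r ^ (α - (d : ℝ))) := by
    have hb : 0 < β - 1 := by linarith
    have ha : 0 < α - d := by linarith
    calc ∫⁻ x in Dᶜ, L x ≤ ∫⁻ x in {x : EuclideanSpace ℝ (Fin d) | 1 / (2 * r) ≤ ‖x‖}, L x :=
          lintegral_mono_set hDc
      _ ≤ ∫⁻ x in {x : EuclideanSpace ℝ (Fin d) | 1 / (2 * r) ≤ ‖x‖},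
          ENNReal.ofReal (η * w₀ * (β / (β - 1))) * ENNReal.ofReal (‖x‖ ^ (-α)) :=
          setLIntegral_mono (by fun_prop) hLb
      _ ≤ _ := by
          rw [lintegral_const_mul _ (by fun_prop), smd_tail d hd α _ hαd hR,
            ← ENNReal.ofReal_mul (by positivity)]
          apply ENNReal.ofReal_le_ofReal
          have hp : (1 / (2 * r)) ^ ((d : ℝ) - α) = 2 ^ (α - (d : ℝ)) * r ^ (α - (d : ℝ)) := by
            rw [one_div, Real.inv_rpow (by positivity), ← Real.rpow_neg (by positivity), neg_sub,
              Real.mul_rpow (by norm_num) hr.le]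
          rw [hp, hc₃, ← hθ]
          set T := (2 : ℝ) ^ (α - (d : ℝ)) * r ^ (α - (d : ℝ)) with hT
          have hT0 : 0 ≤ T := by positivity
          have e1 : η * w₀ * (β / (β - 1)) * (θ * d * (T / (α - d))) =
              (θ * η * w₀ * T / ((β - 1) * (α - d))) * (β * d) := by field_simp
          have e2 : θ * α * η * β ^ 2 * 2 ^ (α - (d : ℝ)) / ((β - 1) * (α - d)) * w₀ *
              r ^ (α - (d : ℝ)) = (θ * η * w₀ * T / ((β - 1) * (α - d))) * (β * (β * α)) := by
            rw [hT]; ring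
          rw [e1, e2]
          have : (d : ℝ) ≤ β * α := by nlinarith
          gcongr
  have hDle : ∫⁻ x in D, L x ≤ ENNReal.ofReal (c₀ * w₀ ^ ((d : ℝ) / α)) :=
    htot ▸ setLIntegral_le_lintegral D L
  have hDfin : ∫⁻ x in D, L x ≠ ⊤ := (hDle.trans_lt ENNReal.ofReal_lt_top).ne
  have hc0n : 0 ≤ c₀ * w₀ ^ ((d : ℝ) / α) := by
    have hne : 0 < α * β - d := by nlinarith
    rw [hc₀]; positivity
  have hmain : ∫ x in D, ∫ w in Ioi (1 : ℝ),
      (1 - Real.exp (-(η * w₀ * w / ‖x‖ ^ α))) * (β * w ^ (-β - 1)) =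
      (∫⁻ x in D, L x).toReal := by
    rw [← integral_toReal hLm.aemeasurable (ae_lt_top hLm hDfin)]
    exact integral_congr_ae (Filter.Eventually.of_forall hinner)
  rw [hmain]
  refine ⟨max_le ENNReal.toReal_nonneg ?_, ?_⟩
  · have hsplit : ENNReal.ofReal (c₀ * w₀ ^ ((d : ℝ) / α)) ≤
        ENNReal.ofReal ((∫⁻ x in D, L x).toReal + c₃ * w₀ * r ^ (α - (d : ℝ))) := by
      rw [← htot, ← lintegral_add_compl L hDm, ENNReal.ofReal_add ENNReal.toReal_nonneg hc3n,
        ENNReal.ofReal_toReal hDfin]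
      gcongr
    have := (ENNReal.ofReal_le_ofReal_iff (add_nonneg ENNReal.toReal_nonneg hc3n)).1 hsplit
    linarith
  · exact ENNReal.toReal_le_of_le_ofReal hc0n hDle
end
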